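/- Let u be a nonnegative smooth solution of the heat equation Δu = ∂_t u on ℝⁿ × (-∞, 0]. Then for each x ∈ ℝⁿ there exists a finite nonnegative Borel measure ν_x on [0,∞) with total mass ν_x([0,∞)) = u(x,0) such that u(x,-t) = ∫₀^∞ e^{-ts} dν_x(s) for all t > 0. -/

import Mathlib

open MeasureTheory Real

noncomputable section

/-- Spatial Laplacian of `f : ℝⁿ → ℝ` at `x` (sum of second partial derivatives). -/
def lap (n : ℕ) (f : EuclideanSpace ℝ (Fin n) → ℝ) (x : EuclideanSpace ℝ (Fin n)) : ℝ :=
  ∑ i : Fin n, fderiv ℝ (fun y => fderiv ℝ f y (EuclideanSpace.single i 1)) x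
    (EuclideanSpace.single i 1)

/-- `u` is a smooth ancient solution of the heat equation on `ℝⁿ × (-∞, 0]`:
it is smooth and satisfies `Δ_x u = ∂_t u` for all `t ≤ 0`. -/
def IsAncientHeat (n : ℕ) (u : EuclideanSpace ℝ (Fin n) × ℝ → ℝ) : Prop :=
  ContDiff ℝ (⊤ : ℕ∞) u ∧ ∀ (x : EuclideanSpace ℝ (Fin n)) (t : ℝ), t ≤ 0 →
    lap n (fun y => u (y, t)) x = deriv (fun s => u (x, s)) t

open Filter Topology
open scoped ContDiff unitInterval

/-- Measures of fixed mass on a compact space have a weak limit point, which computes every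
limit of integrals that exists along the sequence. -/
lemma exists_limit_finiteMeasure {X : Type*} [TopologicalSpace X] [CompactSpace X] [T2Space X]
    [MeasurableSpace X] [BorelSpace X] (C : NNReal) (μ : ℕ → FiniteMeasure X)
    (hμ : ∀ m, (μ m).mass = C) :
    ∃ ρ : FiniteMeasure X, ρ.mass = C ∧ ∀ (g : C(X, ℝ)) (l : ℝ),
      Tendsto (fun m => ∫ x, g x ∂(μ m : Measure X)) atTop (𝓝 l) →
        ∫ x, g x ∂(ρ : Measure X) = l := by
  have hK := isCompact_setOfPred_finiteMeasure_eq_of_compactSpace X C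
  let F : Ultrafilter ℕ := Ultrafilter.of atTop
  obtain ⟨ρ, hρ, hlim⟩ := hK.ultrafilter_le_nhds (F.map μ) (by
    simp only [le_principal_iff]
    exact Filter.mem_map.2 (Filter.univ_mem' hμ))
  refine ⟨ρ, hρ, fun g l hg => ?_⟩
  have h1 : Tendsto μ F (𝓝 ρ) := hlim
  have h2 := FiniteMeasure.tendsto_iff_forall_integral_tendsto.1 h1
    (BoundedContinuousFunction.mkOfCompact g)
  exact tendsto_nhds_unique h2 (hg.mono_left (Ultrafilter.of_le atTop))

/-- The backward difference operator `a ↦ (k ↦ a k - a (k + 1))` on real sequences. -/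
def seqDiff (a : ℕ → ℝ) : ℕ → ℝ := fun k => a k - a (k + 1)

/-- Completely monotone (Hausdorff moment) sequences: all iterated backward differences are
nonnegative. -/
def IsCMSeq (a : ℕ → ℝ) : Prop := ∀ m k, 0 ≤ seqDiff^[m] a k

lemma sum_choose_mul_seqDiff (a : ℕ → ℝ) (N j : ℕ) :
    ∑ i ∈ Finset.range (N + 1), (N.choose i : ℝ) * seqDiff^[N - i] a (i + j) = a j := by
  let S : Module.End ℝ (ℕ → ℝ) := LinearMap.funLeft ℝ ℝ (· + 1)
  have hD : ∀ m, ∀ b : ℕ → ℝ, ((1 - S) ^ m) b = seqDiff^[m] b := by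
    intro m b
    rw [Module.End.pow_apply]
    congr 1
  have hS : ∀ i, ∀ b : ℕ → ℝ, ∀ k, (S ^ i) b k = b (i + k) := by
    intro i
    induction i with
    | zero => intro b k; simp
    | succ i ih =>
      intro b k
      rw [pow_succ, Module.End.mul_apply, ih]
      simp only [S, LinearMap.funLeft_apply]
      congr 1; omega
  have hc : Commute S (1 - S) := (Commute.one_right S).sub_right (Commute.refl S)
  have h := congrArg (fun T : Module.End ℝ (ℕ → ℝ) => T a j) (hc.add_pow N)
  simp only [add_sub_cancel, one_pow, Module.End.one_apply] at h
  rw [h, LinearMap.sum_apply, Finset.sum_apply]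
  refine Finset.sum_congr rfl fun i _ => ?_
  rw [← nsmul_eq_mul', LinearMap.smul_apply, Pi.smul_apply, Module.End.mul_apply, hS, hD,
    nsmul_eq_mul]

lemma exists_descFactorial_div_approx (j : ℕ) :
    ∃ C : ℝ, ∀ m k : ℕ, j ≤ m → k ≤ m →
      |(k.descFactorial j : ℝ) / m.descFactorial j - ((k : ℝ) / m) ^ j| ≤ C / m := by
  induction j with
  | zero => exact ⟨0, by simp⟩
  | succ j ih =>
    obtain ⟨C, hC⟩ := ih
    refine ⟨C + j * (j + 1), fun m k hm hk => ?_⟩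
    have h := hC m k (by omega) hk
    have hmj : (0 : ℝ) < ((m - j : ℕ) : ℝ) := by exact_mod_cast (by omega : 0 < m - j)
    have hm0 : (0 : ℝ) < m := by exact_mod_cast (by omega : 0 < m)
    rw [Nat.descFactorial_succ, Nat.descFactorial_succ, pow_succ]
    push_cast
    set e : ℝ := (k.descFactorial j : ℝ) / m.descFactorial j
    set r : ℝ := (k : ℝ) / m
    set q : ℝ := ((k - j : ℕ) : ℝ) / ((m - j : ℕ) : ℝ)
    have hr0 : 0 ≤ r := by positivity
    have hr1 : r ≤ 1 := div_le_one_of_le₀ (by exact_mod_cast hk) hm0.le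
    have hq0 : 0 ≤ q := by positivity
    have hq1 : q ≤ 1 := div_le_one_of_le₀ (by exact_mod_cast (by omega)) hmj.le
    have hqr : |q - r| ≤ j * (j + 1) / m := by
      have hM : ((m - j : ℕ) : ℝ) = m - j := by push_cast [show j ≤ m by omega]; ring
      have hkm : (k : ℝ) ≤ m := by exact_mod_cast hk
      have hk1 : ((k - j : ℕ) : ℝ) ≤ k := by exact_mod_cast Nat.sub_le _ _
      have hk2 : (k : ℝ) - j ≤ ((k - j : ℕ) : ℝ) := by
        have : k ≤ (k - j) + j := by omega
        have : (k : ℝ) ≤ ((k - j : ℕ) : ℝ) + j := by exact_mod_cast this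
        linarith
      have hj : (0:ℝ) ≤ j := by positivity
      have hmj1 : (1:ℝ) ≤ m - j := by
        rw [← hM]; exact_mod_cast (by omega : 1 ≤ m - j)
      have hk3 : ((k - j : ℕ) : ℝ) * m ≤ k * (m - j) := by
        rcases le_total j k with h | h
        · rw [Nat.cast_sub h]; nlinarith
        · rw [Nat.sub_eq_zero_of_le h]
          push_cast
          have : (0:ℝ) ≤ k := by positivity
          nlinarith
      have e1 : q - r = (((k - j : ℕ) : ℝ) * m - k * (m - j)) / ((m - j) * m) := by
        simp only [q, r, hM]
        field_simp
      rw [e1, abs_div, abs_of_nonpos (by linarith), abs_of_pos (by nlinarith),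
        div_le_div_iff₀ (by nlinarith) hm0]
      have h3 : -(((k - j : ℕ) : ℝ) * m - k * (m - j)) ≤ j * m := by nlinarith
      have h4 : (m : ℝ) ≤ (j + 1) * (m - j) := by nlinarith
      calc -(((k - j : ℕ) : ℝ) * m - k * (m - j)) * m ≤ (j : ℝ) * m * m := by gcongr
        _ ≤ (j : ℝ) * ((j + 1) * (m - j)) * m :=
          mul_le_mul_of_nonneg_right (mul_le_mul_of_nonneg_left h4 hj) hm0.le
        _ = _ := by ring
    have e2 : ((k - j : ℕ) : ℝ) * (k.descFactorial j) / (((m - j : ℕ) : ℝ) * (m.descFactorial j))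
        - r ^ j * r = (e - r ^ j) * q + r ^ j * (q - r) := by
      simp only [e, q]
      rw [mul_div_mul_comm]; ring
    rw [e2]
    calc _ ≤ |e - r ^ j| * |q| + |r ^ j| * |q - r| := by
            rw [← abs_mul, ← abs_mul]; exact abs_add_le _ _
      _ ≤ (C / m) * 1 + 1 * (j * (j + 1) / m) := by
            gcongr
            · exact (abs_nonneg _).trans h
            · rw [abs_of_nonneg hq0]; exact hq1
            · rw [abs_of_nonneg (by positivity)]; exact pow_le_one₀ hr0 hr1
      _ = _ := by ring

/-- The weights of the `m`-th Bernstein approximation of the moment functional reproduce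
the moments up to replacing powers by quotients of falling factorials. -/
lemma IsCMSeq.moment_eq (a : ℕ → ℝ) {m j : ℕ} (hj : j ≤ m) :
    ∑ k ∈ Finset.range (m + 1), ((m.choose k : ℝ) * seqDiff^[m - k] a k) *
      ((k.descFactorial j : ℝ) / m.descFactorial j) = a j := by
  obtain ⟨N, rfl⟩ := Nat.exists_eq_add_of_le hj
  rw [show j + N + 1 = j + (N + 1) by ring, Finset.sum_range_add,
    Finset.sum_eq_zero, zero_add, ← sum_choose_mul_seqDiff a N j]
  · refine Finset.sum_congr rfl fun i hi => ?_
    have hi' : i ≤ N := by simpa [Nat.lt_succ_iff] using hi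
    rw [show j + N - (j + i) = N - i by omega, show j + i = i + j by ring]
    have h1 : ((j + N).choose (i + j) : ℝ) * ((i + j).descFactorial j : ℝ) =
        (N.choose i : ℝ) * ((j + N).descFactorial j : ℝ) := by
      rw [Nat.descFactorial_eq_factorial_mul_choose, Nat.descFactorial_eq_factorial_mul_choose]
      have := Nat.choose_mul (n := j + N) (k := i + j) (s := j) (by omega)
      rw [show j + N - j = N by omega, show i + j - j = i by omega] at this
      have h' : ((j + N).choose (i + j) : ℝ) * ((i + j).choose j) =
          (j + N).choose j * N.choose i := by
        exact_mod_cast this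
      push_cast
      linear_combination (j.factorial : ℝ) * h'
    have h2 : ((j + N).descFactorial j : ℝ) ≠ 0 := by
      exact_mod_cast (Nat.descFactorial_pos.2 (by omega)).ne'
    field_simp
    linear_combination (seqDiff^[N - i] a (i + j)) * h1
  · intro k hk
    rw [Nat.descFactorial_of_lt (by simpa using hk)]
    simp

/-- Solution of the Hausdorff moment problem on `[0, 1]`. -/
theorem IsCMSeq.exists_measure {a : ℕ → ℝ} (ha : IsCMSeq a) :
    ∃ ρ : FiniteMeasure I, ∀ j, ∫ z : I, (z : ℝ) ^ j ∂(ρ : Measure I) = a j := by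
  set c : ℕ → ℕ → ℝ := fun m k => (m.choose k : ℝ) * seqDiff^[m - k] a k
  have hc : ∀ m k, 0 ≤ c m k := fun m k => mul_nonneg (by positivity) (ha _ _)
  have hcs : ∀ m, ∑ k ∈ Finset.range (m + 1), c m k = a 0 := by
    intro m
    simpa using IsCMSeq.moment_eq a (Nat.zero_le m)
  let P : ℕ → ℕ → I := fun m k => Set.projIcc 0 1 zero_le_one ((k : ℝ) / m)
  have hP : ∀ m k, k ≤ m → ((P m k : I) : ℝ) = (k : ℝ) / m := by
    intro m k hk
    simp only [P]
    rw [Set.projIcc_of_mem _ ⟨by positivity,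
      div_le_one_of_le₀ (by exact_mod_cast hk) (by positivity)⟩]
  let μ : ℕ → Measure I := fun m =>
    ∑ k ∈ Finset.range (m + 1), ENNReal.ofReal (c m k) • Measure.dirac (P m k)
  have hμuniv : ∀ m, μ m Set.univ = ENNReal.ofReal (a 0) := by
    intro m
    simp only [μ, Measure.coe_finsetSum, Finset.sum_apply, Measure.smul_apply, measure_univ,
      smul_eq_mul, mul_one]
    rw [← ENNReal.ofReal_sum_of_nonneg (fun k _ => hc m k), hcs]
  have hfin : ∀ m, IsFiniteMeasure (μ m) := fun m => ⟨by rw [hμuniv]; exact ENNReal.ofReal_lt_top⟩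
  have hintegral : ∀ m (g : C(I, ℝ)), ∫ z, g z ∂(μ m) =
      ∑ k ∈ Finset.range (m + 1), c m k * g (P m k) := by
    intro m g
    simp only [μ]
    rw [integral_finsetSum_measure]
    · refine Finset.sum_congr rfl fun k _ => ?_
      rw [integral_smul_measure, integral_dirac, ENNReal.toReal_ofReal (hc m k), smul_eq_mul]
    · intro k _
      exact (integrable_dirac (by finiteness)).smul_measure ENNReal.ofReal_ne_top
  let μ' : ℕ → FiniteMeasure I := fun m => ⟨μ m, hfin m⟩
  have hμ' : ∀ m, (μ' m : Measure I) = μ m := fun _ => rfl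
  obtain ⟨ρ, -, hρ⟩ := exists_limit_finiteMeasure (a 0).toNNReal μ' (fun m => by
    rw [← ENNReal.coe_inj, FiniteMeasure.ennreal_mass, hμ', hμuniv, ENNReal.ofReal])
  refine ⟨ρ, fun j => ?_⟩
  refine hρ ⟨fun z : I => (z : ℝ) ^ j, by fun_prop⟩ (a j) ?_
  obtain ⟨C, hC⟩ := exists_descFactorial_div_approx j
  rw [tendsto_iff_dist_tendsto_zero]
  refine squeeze_zero' (g := fun m : ℕ => a 0 * (C / m)) (Eventually.of_forall fun _ => dist_nonneg)
    ?_ ?_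
  · filter_upwards [eventually_ge_atTop j] with m hm
    have := hintegral m ⟨fun z : I => (z : ℝ) ^ j, by fun_prop⟩
    rw [hμ', this, dist_comm, Real.dist_eq, ← IsCMSeq.moment_eq a hm, ← Finset.sum_sub_distrib]
    refine (Finset.abs_sum_le_sum_abs _ _).trans ?_
    rw [← hcs m, Finset.sum_mul]
    refine Finset.sum_le_sum fun k hk => ?_
    have hk' : k ≤ m := by simpa [Nat.lt_succ_iff] using hk
    change |c m k * _ - c m k * ((P m k : I) : ℝ) ^ j| ≤ _
    rw [hP m k hk', ← mul_sub, abs_mul, abs_of_nonneg (hc m k)]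
    exact mul_le_mul_of_nonneg_left (hC m k hm hk') (hc m k)
  · simpa using (tendsto_const_div_atTop_nhds_zero_nat C).const_mul (a 0)

/-- Bernstein's theorem in the multiplicative variable `z = exp (-s)`. -/
theorem exists_measure_Icc_rpow {g : ℝ → ℝ} (hg : ContinuousOn g (Set.Ici 0))
    (hcm : ∀ h : ℝ, 0 < h → IsCMSeq fun k => g (k * h)) :
    ∃ ρ : FiniteMeasure I, ∀ t : ℝ, 0 ≤ t → ∫ z : I, (z : ℝ) ^ t ∂(ρ : Measure I) = g t := by
  choose κ hκ using fun N : ℕ => (hcm (1 / (N + 1 : ℝ)) (by positivity)).exists_measure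
  let ρ : ℕ → FiniteMeasure I := fun N => (κ N).map (fun z => z ^ (N + 1))
  have hcont : ∀ t : ℝ, 0 ≤ t → Continuous fun z : I => (z : ℝ) ^ t := fun t ht =>
    (Real.continuous_rpow_const ht).comp continuous_subtype_val
  have hρ : ∀ N j : ℕ, ∫ z : I, (z : ℝ) ^ ((j : ℝ) / (N + 1)) ∂(ρ N : Measure I) =
      g (j / (N + 1)) := by
    intro N j
    simp only [ρ, FiniteMeasure.toMeasure_map]
    rw [integral_map (by fun_prop) (hcont _ (by positivity)).aestronglyMeasurable]
    have := hκ N j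
    simp only [mul_one_div] at this
    rw [← this]
    refine integral_congr_ae (Eventually.of_forall fun z => ?_)
    simp only [Set.Icc.coe_pow]
    rw [← Real.rpow_natCast, ← Real.rpow_mul z.2.1, ← Real.rpow_natCast]
    congr 1
    push_cast
    field_simp
  have hintegral : ∀ (N : ℕ) (t : ℝ), 0 ≤ t →
      Integrable (fun z : I => (z : ℝ) ^ t) (ρ N : Measure I) :=
    fun N t ht => (BoundedContinuousFunction.mkOfCompact ⟨_, hcont t ht⟩).integrable _
  obtain ⟨μ, -, hμ⟩ := exists_limit_finiteMeasure (g 0).toNNReal ρ (fun N => by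
    have : (ρ N : Measure I).real Set.univ = g 0 := by simpa using hρ N 0
    rw [← ENNReal.coe_inj, FiniteMeasure.ennreal_mass, ← ofReal_measureReal, this, ENNReal.ofReal])
  refine ⟨μ, fun t ht => ?_⟩
  refine hμ ⟨_, hcont t ht⟩ (g t) ?_
  have hN1 : Tendsto (fun N : ℕ => (N : ℝ) + 1) atTop atTop :=
    tendsto_natCast_atTop_atTop.atTop_add tendsto_const_nhds
  have hfl : Tendsto (fun N : ℕ => (⌊t * (N + 1 : ℝ)⌋₊ : ℝ) / (N + 1)) atTop (𝓝 t) :=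
    (tendsto_nat_floor_mul_div_atTop ht).comp hN1
  have hfl' : Tendsto (fun N : ℕ => ((⌊t * (N + 1 : ℝ)⌋₊ + 1 : ℕ) : ℝ) / (N + 1)) atTop (𝓝 t) := by
    have : Tendsto (fun N : ℕ => 1 / ((N : ℝ) + 1)) atTop (𝓝 0) :=
      tendsto_one_div_add_atTop_nhds_zero_nat
    simpa [add_div] using hfl.add this
  have hgt : ∀ s : ℕ → ℝ, (∀ N, 0 ≤ s N) → Tendsto s atTop (𝓝 t) →
      Tendsto (fun N => g (s N)) atTop (𝓝 (g t)) := fun s hs h =>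
    (hg t ht).tendsto.comp (tendsto_nhdsWithin_iff.2 ⟨h, Eventually.of_forall hs⟩)
  refine tendsto_of_tendsto_of_tendsto_of_le_of_le (hgt _ (fun N => by positivity) hfl')
    (hgt _ (fun N => by positivity) hfl) (fun N => ?_) (fun N => ?_)
  · dsimp only
    rw [← hρ]
    refine integral_mono (hintegral N _ (by positivity)) (hintegral N t ht) fun z => ?_
    refine Real.rpow_le_rpow_of_exponent_ge' z.2.1 z.2.2 ht ?_
    rw [le_div_iff₀ (by positivity)]
    push_cast
    exact (Nat.lt_floor_add_one _).le
  · dsimp only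
    rw [← hρ]
    refine integral_mono (hintegral N t ht) (hintegral N _ (by positivity)) fun z => ?_
    refine Real.rpow_le_rpow_of_exponent_ge' z.2.1 z.2.2 (by positivity) ?_
    rw [div_le_iff₀ (by positivity)]
    exact Nat.floor_le (by positivity)

/-- **Bernstein's theorem** in finite-difference form. -/
theorem exists_measure_laplace {g : ℝ → ℝ} (hg : ContinuousOn g (Set.Ici 0))
    (hcm : ∀ h : ℝ, 0 < h → IsCMSeq fun k => g (k * h)) :
    ∃ ν : Measure ℝ, IsFiniteMeasure ν ∧ ν (Set.Iio 0) = 0 ∧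
      ν Set.univ = ENNReal.ofReal (g 0) ∧
      ∀ t : ℝ, 0 < t → g t = ∫ s, Real.exp (-(t * s)) ∂ν := by
  obtain ⟨ρ, hρ⟩ := exists_measure_Icc_rpow hg hcm
  have hmass : (ρ : Measure I).real Set.univ = g 0 := by
    simpa using hρ 0 le_rfl
  have hms : MeasurableSet ({0}ᶜ : Set I) := (measurableSet_singleton 0).compl
  have hlim : Tendsto (fun n : ℕ => ∫ z : I, (z : ℝ) ^ (1 / ((n : ℝ) + 1)) ∂(ρ : Measure I)) atTop
      (𝓝 (∫ z : I, Set.indicator {0}ᶜ (fun _ => (1 : ℝ)) z ∂(ρ : Measure I))) := by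
    refine tendsto_integral_of_dominated_convergence (fun _ => 1) (fun n => ?_)
      (integrable_const _) (fun n => Eventually.of_forall fun z => ?_)
      (Eventually.of_forall fun z => ?_)
    · exact ((Real.continuous_rpow_const (by positivity)).comp
        continuous_subtype_val).aestronglyMeasurable
    · rw [Real.norm_of_nonneg (Real.rpow_nonneg z.2.1 _)]
      exact Real.rpow_le_one z.2.1 z.2.2 (by positivity)
    · by_cases hz : z = 0
      · subst hz
        have : ∀ n : ℕ, ((0 : I) : ℝ) ^ (1 / ((n : ℝ) + 1)) = 0 := fun n => by
          rw [Set.Icc.coe_zero, Real.zero_rpow (by positivity)]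
        simp only [this]
        simp
      · have hz' : (z : ℝ) ≠ 0 := fun h => hz (Subtype.ext h)
        rw [Set.indicator_of_mem (by simpa using hz)]
        have := (Real.continuousAt_const_rpow (b := 0) hz').tendsto.comp
          (tendsto_one_div_add_atTop_nhds_zero_nat (𝕜 := ℝ))
        simpa [Function.comp_def] using this
  have hlim' : Tendsto (fun n : ℕ => ∫ z : I, (z : ℝ) ^ (1 / ((n : ℝ) + 1)) ∂(ρ : Measure I)) atTop
      (𝓝 (g 0)) := by
    have : ∀ n : ℕ, ∫ z : I, (z : ℝ) ^ (1 / ((n : ℝ) + 1)) ∂(ρ : Measure I) =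
        g (1 / ((n : ℝ) + 1)) := fun n => hρ _ (by positivity)
    simp only [this]
    exact (hg 0 Set.self_mem_Ici).tendsto.comp (tendsto_nhdsWithin_iff.2
      ⟨tendsto_one_div_add_atTop_nhds_zero_nat, Eventually.of_forall fun n =>
        Set.mem_Ici.2 (by positivity)⟩)
  have hzero : (ρ : Measure I) {0} = 0 := by
    have h := tendsto_nhds_unique hlim hlim'
    rw [integral_indicator_const _ hms, smul_eq_mul, mul_one, ← hmass,
      measureReal_compl (measurableSet_singleton 0)] at h
    rw [← measureReal_eq_zero_iff]
    linarith
  have hae : ∀ᵐ z : I ∂(ρ : Measure I), z ≠ 0 := by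
    rw [ae_iff]; simpa using hzero
  have hm : Measurable fun z : I => -Real.log z := by fun_prop
  refine ⟨(ρ : Measure I).map fun z : I => -Real.log z, inferInstance, ?_, ?_, fun t ht => ?_⟩
  · rw [Measure.map_apply hm measurableSet_Iio]
    convert measure_empty (μ := (ρ : Measure I))
    ext z
    simpa using Real.log_nonpos z.2.1 z.2.2
  · rw [Measure.map_apply hm MeasurableSet.univ, Set.preimage_univ, ← hmass, ofReal_measureReal]
  · rw [integral_map hm.aemeasurable (by fun_prop), ← hρ t ht.le]
    refine integral_congr_ae ?_
    filter_upwards [hae] with z hz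
    have hz' : 0 < (z : ℝ) := lt_of_le_of_ne z.2.1 fun h => hz (Subtype.ext h.symm)
    rw [Real.rpow_def_of_pos hz']
    congr 1
    ring

section DirectionalDerivative

variable {V : Type*} [NormedAddCommGroup V] [NormedSpace ℝ V]

/-- The directional derivative of `g` in the direction `v`, as a function. -/
def dirDeriv (v : V) (g : V → ℝ) : V → ℝ := fun p => fderiv ℝ g p v

variable {Ω : Set V} {f g : V → ℝ} {p v w : V}

lemma dirDeriv_contDiffOn (hΩ : IsOpen Ω) (hg : ContDiffOn ℝ ∞ g Ω) (v : V) :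
    ContDiffOn ℝ ∞ (dirDeriv v g) Ω :=
  (hg.fderiv_of_isOpen hΩ (by simp)).clm_apply contDiffOn_const

lemma ContDiffOn.differentiableAt_of_mem (hΩ : IsOpen Ω) (hg : ContDiffOn ℝ ∞ g Ω) (hp : p ∈ Ω) :
    DifferentiableAt ℝ g p :=
  (hg.contDiffAt (hΩ.mem_nhds hp)).differentiableAt (by simp)

lemma dirDeriv_congr (hΩ : IsOpen Ω) (h : Set.EqOn f g Ω) (v : V) :
    Set.EqOn (dirDeriv v f) (dirDeriv v g) Ω := fun p hp => by
  simp only [dirDeriv]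
  rw [(h.eventuallyEq_of_mem (hΩ.mem_nhds hp)).fderiv_eq]

lemma dirDeriv_add (hf : DifferentiableAt ℝ f p) (hg : DifferentiableAt ℝ g p) :
    dirDeriv v (fun q => f q + g q) p = dirDeriv v f p + dirDeriv v g p := by
  simp [dirDeriv, fderiv_fun_add hf hg]

lemma dirDeriv_sub (hf : DifferentiableAt ℝ f p) (hg : DifferentiableAt ℝ g p) :
    dirDeriv v (fun q => f q - g q) p = dirDeriv v f p - dirDeriv v g p := by
  simp [dirDeriv, fderiv_fun_sub hf hg]

lemma dirDeriv_mul (hf : DifferentiableAt ℝ f p) (hg : DifferentiableAt ℝ g p) :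
    dirDeriv v (fun q => f q * g q) p = dirDeriv v f p * g p + f p * dirDeriv v g p := by
  simp [dirDeriv, fderiv_fun_mul hf hg]; ring

lemma dirDeriv_const_mul (c : ℝ) (hf : DifferentiableAt ℝ f p) :
    dirDeriv v (fun q => c * f q) p = c * dirDeriv v f p := by
  simp [dirDeriv, fderiv_const_mul hf]

lemma dirDeriv_sq (hf : DifferentiableAt ℝ f p) :
    dirDeriv v (fun q => f q ^ 2) p = 2 * f p * dirDeriv v f p := by
  simp only [sq]
  rw [dirDeriv_mul hf hf]; ring

lemma dirDeriv_sum {ι : Type*} [Fintype ι] {F : ι → V → ℝ}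
    (hF : ∀ i, DifferentiableAt ℝ (F i) p) :
    dirDeriv v (fun q => ∑ i, F i q) p = ∑ i, dirDeriv v (F i) p := by
  simp [dirDeriv, fderiv_fun_sum fun i _ => hF i]

lemma dirDeriv_comm (hΩ : IsOpen Ω) (hg : ContDiffOn ℝ ∞ g Ω) (hp : p ∈ Ω) (v w : V) :
    dirDeriv v (dirDeriv w g) p = dirDeriv w (dirDeriv v g) p := by
  have hd : DifferentiableAt ℝ (fderiv ℝ g) p :=
    ((hg.fderiv_of_isOpen (m := ∞) hΩ (by simp)).contDiffAt (hΩ.mem_nhds hp)).differentiableAt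
      (by simp)
  have h : ∀ v w, dirDeriv v (dirDeriv w g) p = fderiv ℝ (fderiv ℝ g) p v w := by
    intro v w
    have := (hd.hasFDerivAt.clm_apply (hasFDerivAt_const w p)).fderiv
    change fderiv ℝ (fun q => fderiv ℝ g q w) p v = _
    rw [this]; simp
  rw [h, h]
  exact ((hg.contDiffAt (hΩ.mem_nhds hp)).isSymmSndFDerivAt
    (by simpa using WithTop.coe_le_coe.2 (le_top : (2 : ℕ∞) ≤ ⊤))).eq v w

/-- Necessary conditions on directional derivatives at a maximum along a line. -/
lemma dirDeriv_of_isLocalMax (hΩ : IsOpen Ω) (hg : ContDiffOn ℝ ∞ g Ω) (hp : p ∈ Ω) (v : V)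
    (hmax : IsLocalMax (fun s : ℝ => g (p + s • v)) 0) :
    dirDeriv v g p = 0 ∧ dirDeriv v (dirDeriv v g) p ≤ 0 := by
  have hline : ∀ s : ℝ, HasDerivAt (fun s : ℝ => p + s • v) v s := fun s => by
    simpa using ((hasDerivAt_id s).smul_const v).const_add p
  have hder : ∀ k : V → ℝ, ContDiffOn ℝ ∞ k Ω → ∀ s : ℝ, p + s • v ∈ Ω →
      HasDerivAt (fun s : ℝ => k (p + s • v)) (dirDeriv v k (p + s • v)) s := fun k hk s hs =>
    (hk.differentiableAt_of_mem hΩ hs).hasFDerivAt.comp_hasDerivAt s (hline s)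
  have hev : ∀ᶠ s : ℝ in 𝓝 0, p + s • v ∈ Ω :=
    (hline 0).continuousAt.eventually (hΩ.mem_nhds (by simpa using hp))
  have hp0 : p + (0 : ℝ) • v ∈ Ω := by simpa using hp
  have h1 := hder g hg 0 hp0
  have hd1 : deriv (fun s : ℝ => g (p + s • v)) =ᶠ[𝓝 0] fun s => dirDeriv v g (p + s • v) := by
    filter_upwards [hev] with s hs using (hder g hg s hs).deriv
  have h2 : deriv (deriv (fun s : ℝ => g (p + s • v))) 0 = dirDeriv v (dirDeriv v g) p := by
    rw [hd1.deriv_eq, (hder _ (dirDeriv_contDiffOn hΩ hg v) 0 hp0).deriv]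
    simp
  have h0 := hmax.deriv_eq_zero
  refine ⟨by rw [h1.deriv] at h0; simpa using h0, ?_⟩
  by_contra! hpos
  rw [← h2] at hpos
  have hmin := isLocalMin_of_deriv_deriv_pos hpos h0 h1.continuousAt
  have hconst : (fun s : ℝ => g (p + s • v)) =ᶠ[𝓝 0] fun _ => g (p + (0 : ℝ) • v) := by
    filter_upwards [hmax, hmin] with s hs1 hs2 using le_antisymm hs1 hs2
  have : deriv (fun s : ℝ => g (p + s • v)) =ᶠ[𝓝 0] fun _ => 0 := by
    simpa using hconst.deriv
  rw [this.deriv_eq] at hpos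
  simp at hpos

/-- The evolution of the Li-Yau quantity `|∇f|² - 2 ∂ₜf` for the logarithm `f` of a positive
solution of the heat equation. -/
lemma liYau_evolution {ι : Type*} [Fintype ι] (hΩ : IsOpen Ω) (e : ι → V) (T : V)
    (hf : ContDiffOn ℝ ∞ f Ω)
    (hheat : ∀ p ∈ Ω, dirDeriv T f p =
      ∑ i, dirDeriv (e i) (dirDeriv (e i) f) p + ∑ i, dirDeriv (e i) f p ^ 2) (hp : p ∈ Ω) :
    let w : V → ℝ := fun q => ∑ i, dirDeriv (e i) f q ^ 2 - 2 * dirDeriv T f q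
    dirDeriv T w p - ∑ j, dirDeriv (e j) (dirDeriv (e j) w) p
      - 2 * ∑ j, dirDeriv (e j) f p * dirDeriv (e j) w p =
      -2 * ∑ j, ∑ i, dirDeriv (e j) (dirDeriv (e i) f) p ^ 2 := by
  intro w
  have hs1 : ∀ v, ContDiffOn ℝ ∞ (dirDeriv v f) Ω := dirDeriv_contDiffOn hΩ hf
  have hs2 : ∀ v v', ContDiffOn ℝ ∞ (dirDeriv v (dirDeriv v' f)) Ω :=
    fun v v' => dirDeriv_contDiffOn hΩ (hs1 v') v
  have d1 : ∀ v, ∀ q ∈ Ω, DifferentiableAt ℝ (dirDeriv v f) q :=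
    fun v q hq => (hs1 v).differentiableAt_of_mem hΩ hq
  have d2 : ∀ v v', ∀ q ∈ Ω, DifferentiableAt ℝ (dirDeriv v (dirDeriv v' f)) q :=
    fun v v' q hq => (hs2 v v').differentiableAt_of_mem hΩ hq
  have d1s : ∀ v, ∀ q ∈ Ω, DifferentiableAt ℝ (fun x => dirDeriv v f x ^ 2) q :=
    fun v q hq => (d1 v q hq).fun_pow 2
  have hA : ∀ v, ∀ q ∈ Ω, dirDeriv v w q =
      ∑ i, 2 * (dirDeriv (e i) f q * dirDeriv v (dirDeriv (e i) f) q)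
        - 2 * dirDeriv v (dirDeriv T f) q := by
    intro v q hq
    simp only [w]
    rw [dirDeriv_sub (DifferentiableAt.fun_sum fun i _ => d1s _ q hq)
      ((d1 _ q hq).const_mul 2), dirDeriv_sum fun i => d1s _ q hq,
      dirDeriv_const_mul _ (d1 _ q hq)]
    congr 1
    refine Finset.sum_congr rfl fun i _ => ?_
    rw [dirDeriv_sq (d1 _ q hq)]; ring
  have hB : ∀ v, dirDeriv v (dirDeriv v w) p =
      ∑ i, 2 * (dirDeriv v (dirDeriv (e i) f) p ^ 2
        + dirDeriv (e i) f p * dirDeriv v (dirDeriv v (dirDeriv (e i) f)) p)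
        - 2 * dirDeriv v (dirDeriv v (dirDeriv T f)) p := by
    intro v
    rw [dirDeriv_congr hΩ (hA v) v hp]
    have dm : ∀ i, DifferentiableAt ℝ
        (fun q => dirDeriv (e i) f q * dirDeriv v (dirDeriv (e i) f) q) p :=
      fun i => (d1 _ p hp).mul (d2 _ _ p hp)
    rw [dirDeriv_sub (DifferentiableAt.fun_sum fun i _ => (dm i).const_mul 2)
      ((d2 _ _ p hp).const_mul 2), dirDeriv_sum fun i => (dm i).const_mul 2,
      dirDeriv_const_mul _ (d2 _ _ p hp)]
    congr 1
    refine Finset.sum_congr rfl fun i _ => ?_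
    rw [dirDeriv_const_mul _ (dm i), dirDeriv_mul (d1 _ p hp) (d2 _ _ p hp)]; ring
  have hC : ∀ v, dirDeriv v (dirDeriv T f) p =
      ∑ i, dirDeriv (e i) (dirDeriv (e i) (dirDeriv v f)) p
        + ∑ i, 2 * (dirDeriv (e i) f p * dirDeriv v (dirDeriv (e i) f) p) := by
    intro v
    rw [dirDeriv_congr hΩ hheat v hp]
    rw [dirDeriv_add (DifferentiableAt.fun_sum fun i _ => d2 _ _ p hp)
      (DifferentiableAt.fun_sum fun i _ => d1s _ p hp),
      dirDeriv_sum fun i => d2 _ _ p hp, dirDeriv_sum fun i => d1s _ p hp]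
    congr 1
    · refine Finset.sum_congr rfl fun i _ => ?_
      rw [dirDeriv_comm hΩ (hs1 _) hp]
      exact dirDeriv_congr hΩ (fun q hq => dirDeriv_comm hΩ hf hq _ _) _ hp
    · refine Finset.sum_congr rfl fun i _ => ?_
      rw [dirDeriv_sq (d1 _ p hp)]; ring
  have hCe : ∀ j, dirDeriv (e j) f p * dirDeriv (e j) (dirDeriv T f) p =
      ∑ i, dirDeriv (e j) f p * dirDeriv (e i) (dirDeriv (e i) (dirDeriv (e j) f)) p
        + 2 * ∑ i, dirDeriv (e j) f p *
          (dirDeriv (e i) f p * dirDeriv (e j) (dirDeriv (e i) f) p) := by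
    intro j
    rw [hC (e j), mul_add, Finset.mul_sum, Finset.mul_sum, Finset.mul_sum]
    congr 1
    exact Finset.sum_congr rfl fun i _ => by ring
  have hCs := Finset.sum_congr (s₁ := Finset.univ) rfl fun j _ => hCe j
  rw [Finset.sum_add_distrib, ← Finset.mul_sum, Finset.sum_comm] at hCs
  simp only [← Finset.mul_sum] at hCs
  have hT := hC T
  have hTi : ∀ i, dirDeriv T (dirDeriv (e i) f) p = dirDeriv (e i) (dirDeriv T f) p :=
    fun i => dirDeriv_comm hΩ hf hp T (e i)
  simp only [hTi, ← Finset.mul_sum] at hT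
  have hAT := hA T p hp
  simp only [hTi, ← Finset.mul_sum] at hAT
  have hAe : ∀ j, dirDeriv (e j) f p * dirDeriv (e j) w p =
      2 * (∑ i, dirDeriv (e j) f p * (dirDeriv (e i) f p * dirDeriv (e j) (dirDeriv (e i) f) p))
        - 2 * (dirDeriv (e j) f p * dirDeriv (e j) (dirDeriv T f) p) := by
    intro j
    rw [hA (e j) p hp, mul_sub, Finset.mul_sum, Finset.mul_sum]
    congr 1
    · exact Finset.sum_congr rfl fun i _ => by ring
    · ring
  rw [hAT, hT, Finset.sum_congr rfl fun j _ => hB (e j), Finset.sum_congr rfl fun j _ => hAe j]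
  simp only [Finset.sum_sub_distrib, ← Finset.mul_sum, Finset.sum_add_distrib]
  linarith

end DirectionalDerivative

/-- The algebraic inequality at a maximum point of the localized Li-Yau quantity `φ w`. -/
lemma liYau_algebra {ι : Type*} [Fintype ι] {φ w φt wt B K N : ℝ} {φi wi φii wii fi : ι → ℝ}
    {fij : ι → ι → ℝ} (hφ : 0 < φ) (hw : 0 < w) (hN : 0 < N)
    (h1 : ∀ i, φi i * w + φ * wi i = 0)
    (h2 : ∀ i, φii i * w + 2 * (φi i * wi i) + φ * wii i ≤ 0)
    (h3 : 0 ≤ φt * w + φ * wt)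
    (h4 : wt - ∑ i, wii i - 2 * ∑ i, fi i * wi i = -2 * ∑ j, ∑ i, fij j i ^ 2)
    (h5 : w = -∑ i, fi i ^ 2 - 2 * ∑ i, fij i i)
    (hcard : (Fintype.card ι : ℝ) ≤ N)
    (hφi : ∑ i, φi i ^ 2 ≤ 16 * B * φ) (hφt : φt - ∑ i, φii i ≤ K * B) :
    φ * w ≤ 4 * N * (K + 32 + 64 * N) * B := by
  set S := ∑ j, ∑ i, fij j i ^ 2
  set L := ∑ i, fij i i
  set Q := ∑ i, fi i ^ 2
  have hQ : 0 ≤ Q := Finset.sum_nonneg fun i _ => sq_nonneg _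
  have hLS : L ^ 2 ≤ N * S := by
    have a1 : L ^ 2 ≤ Fintype.card ι * ∑ i, fij i i ^ 2 := by
      simpa using sq_sum_le_card_mul_sum_sq (s := Finset.univ) (f := fun i => fij i i)
    have a2 : ∑ i, fij i i ^ 2 ≤ S := Finset.sum_le_sum fun j _ =>
      Finset.single_le_sum (f := fun i => fij j i ^ 2) (fun i _ => sq_nonneg _) (Finset.mem_univ j)
    have a3 : 0 ≤ ∑ i, fij i i ^ 2 := Finset.sum_nonneg fun i _ => sq_nonneg _
    calc _ ≤ _ := a1
      _ ≤ N * S := mul_le_mul hcard a2 a3 hN.le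
  have s2 : (∑ i, φii i) * w + 2 * ∑ i, φi i * wi i + φ * ∑ i, wii i ≤ 0 := by
    have := Finset.sum_nonpos fun i (_ : i ∈ Finset.univ) => h2 i
    simpa only [Finset.sum_add_distrib, ← Finset.mul_sum, ← Finset.sum_mul] using this
  have s1 : φ * ∑ i, φi i * wi i = -w * ∑ i, φi i ^ 2 := by
    rw [Finset.mul_sum, Finset.mul_sum]
    exact Finset.sum_congr rfl fun i _ => by linear_combination φi i * h1 i
  have s3 : φ * ∑ i, fi i * wi i = -w * ∑ i, fi i * φi i := by
    rw [Finset.mul_sum, Finset.mul_sum]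
    exact Finset.sum_congr rfl fun i _ => by linear_combination fi i * h1 i
  have s4 : -2 * φ * ∑ i, fi i * φi i ≤ φ ^ 2 * Q / (4 * N) + 4 * N * ∑ i, φi i ^ 2 := by
    rw [Finset.mul_sum, Finset.mul_sum, Finset.mul_sum, Finset.sum_div, ← Finset.sum_add_distrib]
    refine Finset.sum_le_sum fun i _ => ?_
    have : 0 ≤ (φ * fi i + 4 * N * φi i) ^ 2 / (4 * N) := by positivity
    have e : (φ * fi i + 4 * N * φi i) ^ 2 / (4 * N) =
      φ ^ 2 * fi i ^ 2 / (4 * N) + 2 * φ * (fi i * φi i) + 4 * N * φi i ^ 2 := by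
      field_simp; ring
    linarith
  set G := ∑ i, φi i ^ 2
  set X := w + Q
  have hX : X = -2 * L := by simp only [X]; rw [h5]; ring
  have hXS : φ ^ 2 * X ^ 2 / (4 * N) ≤ φ ^ 2 * S := by
    rw [div_le_iff₀ (by positivity), hX]
    nlinarith [mul_le_mul_of_nonneg_left hLS (sq_nonneg φ)]
  have main : 0 ≤ φ * w * (φt - ∑ i, φii i) + 2 * w * G + w * (-2 * φ * ∑ i, fi i * φi i)
      - 2 * (φ ^ 2 * S) := by
    have h3' := mul_nonneg hφ.le (sub_nonneg.2 (s2.trans h3))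
    have h4' : wt = ∑ i, wii i + 2 * ∑ i, fi i * wi i - 2 * S := by linarith
    rw [h4'] at h3'
    linear_combination h3' - 2 * s1 + 2 * φ * s3
  have b1 : φ * w * (φt - ∑ i, φii i) ≤ φ * w * (K * B) :=
    mul_le_mul_of_nonneg_left hφt (by positivity)
  have b2 : w * G ≤ w * (16 * B * φ) := mul_le_mul_of_nonneg_left hφi hw.le
  have b3 := mul_le_mul_of_nonneg_left s4 hw.le
  have b4 : w * Q ≤ X ^ 2 := by simp only [X]; nlinarith [mul_nonneg hw.le hQ]
  have b5 : w * (φ ^ 2 * Q / (4 * N)) ≤ φ ^ 2 * X ^ 2 / (4 * N) := by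
    rw [mul_div_assoc', show w * (φ ^ 2 * Q) = φ ^ 2 * (w * Q) by ring]
    gcongr
  have b6 : 4 * N * (w * G) ≤ 4 * N * (w * (16 * B * φ)) := by gcongr
  have b7 : φ ^ 2 * X ^ 2 / (4 * N) ≤ φ * w * ((K + 32 + 64 * N) * B) := by
    linarith
  have b8 : w ^ 2 ≤ X ^ 2 := by simp only [X]; nlinarith [mul_nonneg hw.le hQ]
  rw [div_le_iff₀ (by positivity)] at b7
  have b9 : (φ * w) * (φ * w) ≤ (φ * w) * (4 * N * (K + 32 + 64 * N) * B) := by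
    nlinarith [mul_le_mul_of_nonneg_left b8 (sq_nonneg φ)]
  exact le_of_mul_le_mul_left b9 (mul_pos hφ hw)

section Heat

variable {n : ℕ} {u : EuclideanSpace ℝ (Fin n) × ℝ → ℝ}

/-- The `i`-th spatial unit vector of the space-time `ℝⁿ × ℝ`. -/
def spaceDir (i : Fin n) : EuclideanSpace ℝ (Fin n) × ℝ := (EuclideanSpace.single i 1, 0)

/-- The time unit vector of the space-time `ℝⁿ × ℝ`. -/
def timeDir (n : ℕ) : EuclideanSpace ℝ (Fin n) × ℝ := (0, 1)

lemma fderiv_slice_apply {x : EuclideanSpace ℝ (Fin n)} {t : ℝ} (hu : DifferentiableAt ℝ u (x, t))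
    (v : EuclideanSpace ℝ (Fin n)) :
    fderiv ℝ (fun y => u (y, t)) x v = dirDeriv (v, 0) u (x, t) := by
  have h0 : HasFDerivAt (fun y => (y, t))
      (ContinuousLinearMap.inl ℝ (EuclideanSpace ℝ (Fin n)) ℝ) x :=
    hasFDerivAt_prodMk_left x t
  have h := HasFDerivAt.comp (g := u) x hu.hasFDerivAt h0
  change fderiv ℝ (u ∘ fun y => (y, t)) x v = _
  rw [h.fderiv]
  simp [dirDeriv]

lemma deriv_slice {x : EuclideanSpace ℝ (Fin n)} {t : ℝ} (hu : DifferentiableAt ℝ u (x, t)) :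
    deriv (fun s => u (x, s)) t = dirDeriv (timeDir n) u (x, t) := by
  have h := hu.hasFDerivAt.comp_hasDerivAt t ((hasDerivAt_const t x).prodMk (hasDerivAt_id t))
  exact h.deriv

lemma lap_slice (hu : ContDiff ℝ ∞ u) (x : EuclideanSpace ℝ (Fin n)) (t : ℝ) :
    lap n (fun y => u (y, t)) x =
      ∑ i, dirDeriv (spaceDir i) (dirDeriv (spaceDir i) u) (x, t) := by
  refine Finset.sum_congr rfl fun i _ => ?_
  have h1 : ∀ y, fderiv ℝ (fun y => u (y, t)) y (EuclideanSpace.single i 1) =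
      dirDeriv (spaceDir i) u (y, t) := fun y =>
    fderiv_slice_apply (hu.differentiable (by simp)).differentiableAt _
  simp only [h1]
  have h2 := (dirDeriv_contDiffOn isOpen_univ hu.contDiffOn (spaceDir i)).differentiableAt_of_mem
    isOpen_univ (Set.mem_univ (x, t))
  exact fderiv_slice_apply h2 _

lemma IsAncientHeat.dirDeriv_timeDir (hu : IsAncientHeat n u)
    {p : EuclideanSpace ℝ (Fin n) × ℝ} (hp : p.2 ≤ 0) :
    dirDeriv (timeDir n) u p = ∑ i, dirDeriv (spaceDir i) (dirDeriv (spaceDir i) u) p := by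
  rw [← lap_slice hu.1 p.1 p.2, hu.2 p.1 p.2 hp,
    deriv_slice (hu.1.differentiable (by simp)).differentiableAt]

/-- The polynomial cutoff function `(R² - |x - x₀|²)² (t - t₀ + R²)`. -/
def parabolicCutoff (R : ℝ) (p₀ p : EuclideanSpace ℝ (Fin n) × ℝ) : ℝ :=
  (R ^ 2 - ‖p.1 - p₀.1‖ ^ 2) ^ 2 * (p.2 - p₀.2 + R ^ 2)

section Cutoff

variable (R : ℝ) (p₀ p : EuclideanSpace ℝ (Fin n) × ℝ)

lemma parabolicCutoff_contDiff : ContDiff ℝ ∞ (parabolicCutoff (n := n) R p₀) := by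
  have : ContDiff ℝ ∞ fun p : EuclideanSpace ℝ (Fin n) × ℝ => ‖p.1 - p₀.1‖ ^ 2 :=
    (contDiff_fst.sub contDiff_const).norm_sq ℝ
  exact ((contDiff_const.sub this).pow 2).mul ((contDiff_snd.sub contDiff_const).add contDiff_const)

lemma hasFDerivAt_radial :
    HasFDerivAt (fun p : EuclideanSpace ℝ (Fin n) × ℝ => R ^ 2 - ‖p.1 - p₀.1‖ ^ 2)
      (-((2 • innerSL ℝ (p.1 - p₀.1)).comp
        (ContinuousLinearMap.fst ℝ (EuclideanSpace ℝ (Fin n)) ℝ))) p := by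
  have h : HasFDerivAt (fun p : EuclideanSpace ℝ (Fin n) × ℝ => p.1 - p₀.1)
      (ContinuousLinearMap.fst ℝ (EuclideanSpace ℝ (Fin n)) ℝ) p := hasFDerivAt_fst.sub_const _
  exact h.norm_sq.const_sub _

lemma dirDeriv_parabolicCutoff (v : EuclideanSpace ℝ (Fin n) × ℝ) :
    dirDeriv v (parabolicCutoff R p₀) p =
      -4 * (R ^ 2 - ‖p.1 - p₀.1‖ ^ 2) * (p.2 - p₀.2 + R ^ 2) * inner ℝ (p.1 - p₀.1) v.1
        + (R ^ 2 - ‖p.1 - p₀.1‖ ^ 2) ^ 2 * v.2 := by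
  have h1 := hasFDerivAt_radial R p₀ p
  have h2 : HasFDerivAt (fun p : EuclideanSpace ℝ (Fin n) × ℝ => p.2 - p₀.2 + R ^ 2)
      (ContinuousLinearMap.snd ℝ (EuclideanSpace ℝ (Fin n)) ℝ) p :=
    (hasFDerivAt_snd.sub_const _).add_const _
  have h := (h1.pow 2).mul h2
  simp only [dirDeriv]
  rw [show fderiv ℝ (parabolicCutoff R p₀) p = _ from h.fderiv]
  simp [inner_sub_left]
  ring

lemma dirDeriv_spaceDir_parabolicCutoff (i : Fin n) :
    dirDeriv (spaceDir i) (parabolicCutoff R p₀) p =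
      -4 * (R ^ 2 - ‖p.1 - p₀.1‖ ^ 2) * (p.2 - p₀.2 + R ^ 2) * (p.1 i - p₀.1 i) := by
  rw [dirDeriv_parabolicCutoff]
  simp [spaceDir, EuclideanSpace.inner_single_right]

lemma dirDeriv_timeDir_parabolicCutoff :
    dirDeriv (timeDir n) (parabolicCutoff R p₀) p = (R ^ 2 - ‖p.1 - p₀.1‖ ^ 2) ^ 2 := by
  rw [dirDeriv_parabolicCutoff]
  simp [timeDir]

lemma dirDeriv_dirDeriv_parabolicCutoff (i : Fin n) :
    dirDeriv (spaceDir i) (dirDeriv (spaceDir i) (parabolicCutoff R p₀)) p =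
      (p.2 - p₀.2 + R ^ 2) * (8 * (p.1 i - p₀.1 i) ^ 2 - 4 * (R ^ 2 - ‖p.1 - p₀.1‖ ^ 2)) := by
  have h1 := hasFDerivAt_radial R p₀ p
  have h2 : HasFDerivAt (fun p : EuclideanSpace ℝ (Fin n) × ℝ => p.2 - p₀.2 + R ^ 2)
      (ContinuousLinearMap.snd ℝ (EuclideanSpace ℝ (Fin n)) ℝ) p :=
    (hasFDerivAt_snd.sub_const _).add_const _
  have h3 : HasFDerivAt (fun p : EuclideanSpace ℝ (Fin n) × ℝ => p.1 i - p₀.1 i)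
      ((EuclideanSpace.proj i : EuclideanSpace ℝ (Fin n) →L[ℝ] ℝ).comp
        (ContinuousLinearMap.fst ℝ (EuclideanSpace ℝ (Fin n)) ℝ)) p :=
    (((EuclideanSpace.proj i : EuclideanSpace ℝ (Fin n) →L[ℝ] ℝ).comp
      (ContinuousLinearMap.fst ℝ (EuclideanSpace ℝ (Fin n)) ℝ)).hasFDerivAt).sub_const _
  have h := ((h1.const_mul (-4)).mul h2).mul h3
  rw [show dirDeriv (spaceDir i) (parabolicCutoff R p₀) = _ from
    funext fun q => dirDeriv_spaceDir_parabolicCutoff R p₀ q i]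
  change fderiv ℝ (((fun y : EuclideanSpace ℝ (Fin n) × ℝ => -4 * (R ^ 2 - ‖y.1 - p₀.1‖ ^ 2)) *
    fun p => p.2 - p₀.2 + R ^ 2) * fun p => p.1 i - p₀.1 i) p (spaceDir i) = _
  rw [h.fderiv]
  simp [spaceDir, EuclideanSpace.inner_single_right]
  ring

end Cutoff

lemma sum_sq_sub_eq (x y : EuclideanSpace ℝ (Fin n)) : ∑ i, (x i - y i) ^ 2 = ‖x - y‖ ^ 2 := by
  rw [EuclideanSpace.norm_sq_eq]
  simp

/-- Local Li-Yau estimate, in terms of the logarithm `f` of a positive solution. -/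
lemma liYau_local {f : EuclideanSpace ℝ (Fin n) × ℝ → ℝ}
    (hf : ContDiffOn ℝ ∞ f {p | p.2 < 0})
    (hheat : ∀ p : EuclideanSpace ℝ (Fin n) × ℝ, p.2 < 0 → dirDeriv (timeDir n) f p =
      ∑ i, dirDeriv (spaceDir i) (dirDeriv (spaceDir i) f) p + ∑ i, dirDeriv (spaceDir i) f p ^ 2)
    {p₀ : EuclideanSpace ℝ (Fin n) × ℝ} (hp₀ : p₀.2 < 0) {R : ℝ} (hR : 0 < R)
    (hw₀ : 0 < ∑ i, dirDeriv (spaceDir i) f p₀ ^ 2 - 2 * dirDeriv (timeDir n) f p₀) :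
    R ^ 6 * (∑ i, dirDeriv (spaceDir i) f p₀ ^ 2 - 2 * dirDeriv (timeDir n) f p₀) ≤
      4 * (n + 1) * ((1 + 4 * n) + 32 + 64 * (n + 1)) * R ^ 4 := by
  set Ω : Set (EuclideanSpace ℝ (Fin n) × ℝ) := {p | p.2 < 0}
  have hΩ : IsOpen Ω := isOpen_lt continuous_snd continuous_const
  set w : EuclideanSpace ℝ (Fin n) × ℝ → ℝ :=
    fun q => ∑ i, dirDeriv (spaceDir i) f q ^ 2 - 2 * dirDeriv (timeDir n) f q with hw_def
  change R ^ 6 * w p₀ ≤ _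
  change 0 < w p₀ at hw₀
  have hwC : ContDiffOn ℝ ∞ w Ω :=
    (ContDiffOn.sum fun i _ => (dirDeriv_contDiffOn hΩ hf _).pow 2).sub
      (contDiffOn_const.mul (dirDeriv_contDiffOn hΩ hf _))
  set φ := parabolicCutoff R p₀ with hφ_def
  have hφC : ContDiffOn ℝ ∞ φ Ω := (parabolicCutoff_contDiff R p₀).contDiffOn
  set G : EuclideanSpace ℝ (Fin n) × ℝ → ℝ := fun q => φ q * w q with hG_def
  have hGC : ContDiffOn ℝ ∞ G Ω := hφC.mul hwC
  set Q : Set (EuclideanSpace ℝ (Fin n) × ℝ) :=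
    Metric.closedBall p₀.1 R ×ˢ Set.Icc (p₀.2 - R ^ 2) p₀.2
  have hQ : IsCompact Q := (isCompact_closedBall _ _).prod isCompact_Icc
  have hQΩ : Q ⊆ Ω := fun q hq => lt_of_le_of_lt hq.2.2 hp₀
  have hp₀Q : p₀ ∈ Q := ⟨by simp [hR.le], by simp; positivity⟩
  obtain ⟨p, hpQ, hpmax⟩ := hQ.exists_isMaxOn ⟨p₀, hp₀Q⟩ (hGC.continuousOn.mono hQΩ)
  have hpΩ := hQΩ hpQ
  have hG₀ : G p₀ = R ^ 6 * w p₀ := by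
    have : φ p₀ = R ^ 6 := by
      simp only [hφ_def, parabolicCutoff, sub_self, norm_zero]; ring
    simp only [hG_def, this]
  have hGp : R ^ 6 * w p₀ ≤ φ p * w p := hG₀ ▸ hpmax hp₀Q
  refine hGp.trans ?_
  have hGpos : 0 < φ p * w p := lt_of_lt_of_le (by positivity) hGp
  set ψ : ℝ := R ^ 2 - ‖p.1 - p₀.1‖ ^ 2 with hψ_def
  set τ : ℝ := p.2 - p₀.2 + R ^ 2 with hτ_def
  have hφp : φ p = ψ ^ 2 * τ := rfl
  have hball : ‖p.1 - p₀.1‖ ≤ R := by simpa [dist_eq_norm] using hpQ.1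
  have hτ0 : 0 ≤ τ := by simp only [hτ_def]; linarith [hpQ.2.1]
  have hτR : τ ≤ R ^ 2 := by simp only [hτ_def]; linarith [hpQ.2.2]
  have hψ0 : 0 ≤ ψ := sub_nonneg.2 (by gcongr)
  have hψR : ψ ≤ R ^ 2 := by simp only [hψ_def]; nlinarith [sq_nonneg ‖p.1 - p₀.1‖]
  have hφpos : 0 < φ p := by
    refine lt_of_le_of_ne (hφp ▸ by positivity) fun h => ?_
    rw [← h] at hGpos; simp at hGpos
  have hwpos : 0 < w p := pos_of_mul_pos_right hGpos hφpos.le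
  have hτpos : 0 < τ := lt_of_le_of_ne hτ0 fun h => by
    rw [hφp, ← h] at hφpos; simp at hφpos
  have hψpos : 0 < ψ := lt_of_le_of_ne hψ0 fun h => by
    rw [hφp, ← h] at hφpos; simp at hφpos
  have hball' : ‖p.1 - p₀.1‖ < R := lt_of_pow_lt_pow_left₀ 2 hR.le (by linarith)
  have dφ : ∀ {q}, q ∈ Ω → DifferentiableAt ℝ φ q := fun hq => hφC.differentiableAt_of_mem hΩ hq
  have dw : ∀ {q}, q ∈ Ω → DifferentiableAt ℝ w q := fun hq => hwC.differentiableAt_of_mem hΩ hq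
  have hG1 : ∀ v, Set.EqOn (dirDeriv v G)
      (fun q => dirDeriv v φ q * w q + φ q * dirDeriv v w q) Ω :=
    fun v q hq => dirDeriv_mul (dφ hq) (dw hq)
  have dφ1 : ∀ v, DifferentiableAt ℝ (dirDeriv v φ) p := fun v =>
    (dirDeriv_contDiffOn hΩ hφC v).differentiableAt_of_mem hΩ hpΩ
  have dw1 : ∀ v, DifferentiableAt ℝ (dirDeriv v w) p := fun v =>
    (dirDeriv_contDiffOn hΩ hwC v).differentiableAt_of_mem hΩ hpΩ
  have hG2 : ∀ v, dirDeriv v (dirDeriv v G) p = dirDeriv v (dirDeriv v φ) p * w p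
      + 2 * (dirDeriv v φ p * dirDeriv v w p) + φ p * dirDeriv v (dirDeriv v w) p := by
    intro v
    rw [dirDeriv_congr hΩ (hG1 v) v hpΩ, dirDeriv_add ((dφ1 v).fun_mul (dw hpΩ))
      ((dφ hpΩ).fun_mul (dw1 v)), dirDeriv_mul (dφ1 v) (dw hpΩ), dirDeriv_mul (dφ hpΩ) (dw1 v)]
    ring
  have hspace : ∀ i : Fin n, IsLocalMax (fun s : ℝ => G (p + s • spaceDir i)) 0 := by
    intro i
    have hc : Continuous fun s : ℝ =>
        ‖(p + s • (spaceDir i : EuclideanSpace ℝ (Fin n) × ℝ)).1 - p₀.1‖ := by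
      fun_prop
    have : ∀ᶠ s : ℝ in 𝓝 0, ‖(p + s • (spaceDir i : EuclideanSpace ℝ (Fin n) × ℝ)).1 - p₀.1‖ < R :=
      hc.continuousAt.eventually_lt continuousAt_const (by simpa using hball')
    filter_upwards [this] with s hs
    have hmem : p + s • spaceDir i ∈ Q :=
      ⟨by simpa [dist_eq_norm] using hs.le, by simpa [spaceDir] using hpQ.2⟩
    simpa using hpmax hmem
  have htime : 0 ≤ dirDeriv (timeDir n) G p := by
    have hd : HasDerivAt (fun s : ℝ => G (p + s • timeDir n)) (dirDeriv (timeDir n) G p) 0 := by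
      have hl : HasDerivAt (fun s : ℝ => p + s • timeDir n) (timeDir n) 0 := by
        simpa using ((hasDerivAt_id (0 : ℝ)).smul_const (timeDir n)).const_add p
      have h0 : p + (0 : ℝ) • timeDir n = p := by simp
      have hg := (hGC.differentiableAt_of_mem hΩ hpΩ).hasFDerivAt
      rw [← h0] at hg
      have := hg.comp_hasDerivAt (0 : ℝ) hl
      rwa [h0] at this
    have hsl := (hasDerivWithinAt_iff_tendsto_slope' (s := Set.Iio 0) (by simp)).1
      hd.hasDerivWithinAt
    refine ge_of_tendsto hsl ?_
    have : Set.Ioo (-τ) 0 ∈ 𝓝[<] (0 : ℝ) := Ioo_mem_nhdsLT (by linarith)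
    filter_upwards [this] with s hs
    have hmem : p + s • timeDir n ∈ Q := by
      refine ⟨by simpa [timeDir] using hpQ.1, ?_, ?_⟩
      · simp only [timeDir, Prod.snd_add, Prod.smul_snd, smul_eq_mul, mul_one]
        linarith [hs.1]
      · simp only [timeDir, Prod.snd_add, Prod.smul_snd, smul_eq_mul, mul_one]
        linarith [hs.2, hpQ.2.2]
    have hle : G (p + s • timeDir n) ≤ G p := hpmax hmem
    rw [slope_def_field]
    simp only [zero_smul, add_zero, sub_zero]
    exact div_nonneg_of_nonpos (by linarith) hs.2.le
  have hmaxi := fun i => dirDeriv_of_isLocalMax hΩ hGC hpΩ _ (hspace i)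
  have hN : (0 : ℝ) < n + 1 := by positivity
  have hy : ∑ i, (p.1 i - p₀.1 i) ^ 2 ≤ R ^ 2 := by
    rw [sum_sq_sub_eq]; gcongr
  have hy0 : 0 ≤ ∑ i, (p.1 i - p₀.1 i) ^ 2 := Finset.sum_nonneg fun i _ => sq_nonneg _
  refine liYau_algebra (φi := fun i => dirDeriv (spaceDir i) φ p)
    (φii := fun i => dirDeriv (spaceDir i) (dirDeriv (spaceDir i) φ) p)
    (φt := dirDeriv (timeDir n) φ p) (wt := dirDeriv (timeDir n) w p)
    (wi := fun i => dirDeriv (spaceDir i) w p)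
    (wii := fun i => dirDeriv (spaceDir i) (dirDeriv (spaceDir i) w) p)
    (fi := fun i => dirDeriv (spaceDir i) f p)
    (fij := fun j i => dirDeriv (spaceDir j) (dirDeriv (spaceDir i) f) p)
    hφpos hwpos hN (fun i => ?_) (fun i => ?_) ?_ ?_ ?_ ?_ ?_ ?_
  · rw [← (hmaxi i).1, hG1 _ hpΩ]
  · rw [← hG2]; exact (hmaxi i).2
  · rw [hG1 _ hpΩ] at htime; exact htime
  · exact liYau_evolution hΩ spaceDir (timeDir n) hf hheat hpΩ
  · simp only [hw_def]
    rw [hheat p hpΩ]; ring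
  · simp
  · simp only [hφ_def, dirDeriv_spaceDir_parabolicCutoff]
    rw [← hφ_def, hφp]
    simp only [mul_pow, ← Finset.mul_sum]
    calc _ = 16 * ψ ^ 2 * τ * (τ * ∑ i, (p.1 i - p₀.1 i) ^ 2) := by ring
      _ ≤ 16 * ψ ^ 2 * τ * (R ^ 2 * R ^ 2) := by gcongr
      _ = _ := by ring
  · simp only [hφ_def, dirDeriv_timeDir_parabolicCutoff, dirDeriv_dirDeriv_parabolicCutoff]
    rw [← Finset.mul_sum, Finset.sum_sub_distrib, ← Finset.mul_sum]
    simp only [Finset.sum_const, Finset.card_univ, Fintype.card_fin, nsmul_eq_mul]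
    have a1 : ψ ^ 2 ≤ R ^ 4 := by nlinarith
    have a2 : τ * ψ ≤ R ^ 4 := by nlinarith
    have a3 : (n : ℝ) * (τ * ψ) ≤ n * R ^ 4 := by gcongr
    have a4 : 0 ≤ τ * ∑ i, (p.1 i - p₀.1 i) ^ 2 := by positivity
    linarith

lemma IsAncientHeat.dirDeriv_timeDir_nonneg_of_pos (hu : IsAncientHeat n u)
    (hpos : ∀ (x : EuclideanSpace ℝ (Fin n)) (t : ℝ), t ≤ 0 → 0 < u (x, t))
    {p₀ : EuclideanSpace ℝ (Fin n) × ℝ} (hp₀ : p₀.2 < 0) : 0 ≤ dirDeriv (timeDir n) u p₀ := by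
  set Ω : Set (EuclideanSpace ℝ (Fin n) × ℝ) := {p | p.2 < 0}
  have hΩ : IsOpen Ω := isOpen_lt continuous_snd continuous_const
  have hne : ∀ p ∈ Ω, u p ≠ 0 := fun p hp => (hpos p.1 p.2 (le_of_lt hp)).ne'
  have huC : ContDiffOn ℝ ∞ u Ω := hu.1.contDiffOn
  have hf : ContDiffOn ℝ ∞ (fun p => Real.log (u p)) Ω := huC.log hne
  have hf1 : ∀ v, Set.EqOn (dirDeriv v fun p => Real.log (u p))
      (fun p => dirDeriv v u p * (u p)⁻¹) Ω := fun v p hp => by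
    simp only [dirDeriv]
    rw [((huC.differentiableAt_of_mem hΩ hp).hasFDerivAt.log (hne p hp)).fderiv]
    simp [mul_comm]
  have hf2 : ∀ v, ∀ p ∈ Ω, dirDeriv v (dirDeriv v fun p => Real.log (u p)) p =
      dirDeriv v (dirDeriv v u) p * (u p)⁻¹ - (dirDeriv v u p * (u p)⁻¹) ^ 2 := by
    intro v p hp
    have du := huC.differentiableAt_of_mem hΩ hp
    rw [dirDeriv_congr hΩ (hf1 v) v hp, dirDeriv_mul
      ((dirDeriv_contDiffOn hΩ huC v).differentiableAt_of_mem hΩ hp) (du.fun_inv (hne p hp))]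
    have : dirDeriv v (fun q => (u q)⁻¹) p = -(dirDeriv v u p * (u p)⁻¹ ^ 2) := by
      change fderiv ℝ ((fun y => y⁻¹) ∘ u) p v = _
      rw [((hasDerivAt_inv (hne p hp)).comp_hasFDerivAt p du.hasFDerivAt).fderiv]
      simp [dirDeriv, mul_comm]
    rw [this]; ring
  have hheat : ∀ p ∈ Ω, dirDeriv (timeDir n) (fun p => Real.log (u p)) p =
      ∑ i, dirDeriv (spaceDir i) (dirDeriv (spaceDir i) fun p => Real.log (u p)) p
        + ∑ i, dirDeriv (spaceDir i) (fun p => Real.log (u p)) p ^ 2 := by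
    intro p hp
    rw [← Finset.sum_add_distrib, hf1 _ hp]
    change dirDeriv (timeDir n) u p * (u p)⁻¹ = _
    rw [hu.dirDeriv_timeDir (le_of_lt hp), Finset.sum_mul]
    refine Finset.sum_congr rfl fun i _ => ?_
    rw [hf2 _ p hp, hf1 _ hp]; ring
  by_contra! hneg
  have hw : 0 < ∑ i, dirDeriv (spaceDir i) (fun p => Real.log (u p)) p₀ ^ 2
      - 2 * dirDeriv (timeDir n) (fun p => Real.log (u p)) p₀ := by
    have h1 : dirDeriv (timeDir n) (fun p => Real.log (u p)) p₀ < 0 := by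
      rw [hf1 _ hp₀]
      exact mul_neg_of_neg_of_pos hneg (inv_pos.2 (hpos p₀.1 p₀.2 hp₀.le))
    have h2 : 0 ≤ ∑ i, dirDeriv (spaceDir i) (fun p => Real.log (u p)) p₀ ^ 2 :=
      Finset.sum_nonneg fun i _ => sq_nonneg _
    linarith
  set w₀ := ∑ i, dirDeriv (spaceDir i) (fun p => Real.log (u p)) p₀ ^ 2
      - 2 * dirDeriv (timeDir n) (fun p => Real.log (u p)) p₀
  set C : ℝ := 4 * (n + 1) * ((1 + 4 * n) + 32 + 64 * (n + 1))
  have hC : 0 < C := by positivity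
  have hR : 0 < √(C / w₀ + 1) := by positivity
  have h := liYau_local hf hheat hp₀ hR hw
  have hR2 : √(C / w₀ + 1) ^ 2 = C / w₀ + 1 := Real.sq_sqrt (by positivity)
  set R := √(C / w₀ + 1)
  have h' : R ^ 4 * (R ^ 2 * w₀) ≤ R ^ 4 * C := by
    calc _ = R ^ 6 * w₀ := by ring
      _ ≤ C * R ^ 4 := h
      _ = _ := by ring
  have h'' := le_of_mul_le_mul_left h' (by positivity)
  rw [hR2, add_mul, div_mul_cancel₀ _ hw.ne'] at h''
  linarith

/-- Nonnegative ancient solutions of the heat equation are nondecreasing in time. -/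
theorem IsAncientHeat.mono (hu : IsAncientHeat n u)
    (hnonneg : ∀ (x : EuclideanSpace ℝ (Fin n)) (t : ℝ), t ≤ 0 → 0 ≤ u (x, t))
    (x : EuclideanSpace ℝ (Fin n)) : MonotoneOn (fun t => u (x, t)) (Set.Iic 0) := by
  have hu1 : IsAncientHeat n fun p => u p + 1 := by
    refine ⟨hu.1.add contDiff_const, fun x t ht => ?_⟩
    have := hu.2 x t ht
    simp only [lap, fderiv_add_const, deriv_add_const] at this ⊢
    exact this
  have hud : Differentiable ℝ u := hu.1.differentiable (by simp)
  have hcd : ContDiff ℝ ∞ fun t => u (x, t) := hu.1.comp (contDiff_const.prodMk contDiff_id)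
  refine monotoneOn_of_deriv_nonneg (convex_Iic 0) hcd.continuous.continuousOn
    (hcd.differentiable (by simp)).differentiableOn fun t ht => ?_
  rw [interior_Iic] at ht
  rw [deriv_slice hud.differentiableAt]
  have := hu1.dirDeriv_timeDir_nonneg_of_pos (fun x t ht => by linarith [hnonneg x t ht])
    (p₀ := (x, t)) ht
  simpa [dirDeriv] using this

lemma IsAncientHeat.sub_shift (hu : IsAncientHeat n u) {h : ℝ} (hh : 0 ≤ h) :
    IsAncientHeat n fun p => u p - u (p.1, p.2 - h) := by
  have hsh : ContDiff ℝ ∞ fun p : EuclideanSpace ℝ (Fin n) × ℝ => u (p.1, p.2 - h) :=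
    hu.1.comp (contDiff_fst.prodMk (contDiff_snd.sub contDiff_const))
  refine ⟨hu.1.sub hsh, fun x t ht => ?_⟩
  have hsl : ∀ t, ContDiff ℝ ∞ fun y => u (y, t) := fun t =>
    hu.1.comp (contDiff_id.prodMk contDiff_const)
  have hslt : Differentiable ℝ fun t => u (x, t) :=
    (hu.1.comp (contDiff_const.prodMk contDiff_id)).differentiable (by simp)
  have hsub : lap n (fun y => u (y, t) - u (y, t - h)) x =
      lap n (fun y => u (y, t)) x - lap n (fun y => u (y, t - h)) x := by
    have h1 : ∀ t y, DifferentiableAt ℝ (fun y => u (y, t)) y := fun t y =>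
      ((hsl t).differentiable (by simp)).differentiableAt
    have h2 : ∀ t v, DifferentiableAt ℝ (fun y => fderiv ℝ (fun y => u (y, t)) y v) x := fun t v =>
      (dirDeriv_contDiffOn isOpen_univ (hsl t).contDiffOn v).differentiableAt_of_mem isOpen_univ
        (Set.mem_univ x)
    simp only [lap, ← Finset.sum_sub_distrib]
    refine Finset.sum_congr rfl fun i _ => ?_
    simp only [fderiv_fun_sub (h1 _ _) (h1 _ _), sub_apply]
    rw [fderiv_fun_sub (h2 _ _) (h2 _ _), sub_apply]
  have ht2 : deriv (fun s => u (x, s) - u (x, s - h)) t =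
      deriv (fun s => u (x, s)) t - deriv (fun s => u (x, s)) (t - h) := by
    have hd : DifferentiableAt ℝ (fun s => u (x, s - h)) t :=
      ((hu.1.comp (contDiff_const.prodMk (contDiff_id.sub contDiff_const))).differentiable
        (by simp)).differentiableAt
    rw [deriv_fun_sub hslt.differentiableAt hd]
    congr 1
    exact deriv_comp_sub_const (f := fun s => u (x, s)) h t
  simp only
  rw [hsub, ht2, hu.2 x t ht, hu.2 x (t - h) (by linarith)]

lemma IsAncientHeat.isCMSeq (hu : IsAncientHeat n u)
    (hnonneg : ∀ (x : EuclideanSpace ℝ (Fin n)) (t : ℝ), t ≤ 0 → 0 ≤ u (x, t))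
    (x : EuclideanSpace ℝ (Fin n)) {h : ℝ} (hh : 0 < h) : IsCMSeq fun k => u (x, -(k * h)) := by
  intro m
  induction m generalizing u with
  | zero => exact fun k => hnonneg x _ (by simp; positivity)
  | succ m ih =>
    rw [Function.iterate_succ_apply]
    have := ih (hu.sub_shift hh.le) fun x t ht => sub_nonneg.2 <|
      hu.mono hnonneg x (Set.mem_Iic.2 (by linarith)) (Set.mem_Iic.2 ht) (by linarith)
    have hdiff : seqDiff (fun k : ℕ => u (x, -(k * h))) =
        fun k : ℕ => u (x, -(k * h)) - u (x, -(k * h) - h) := by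
      ext k
      simp only [seqDiff]
      congr 3
      push_cast
      ring
    rw [hdiff]
    exact this

end Heat

/-- for a nonnegative ancient solution of the heat equation on
`ℝⁿ × (-∞, 0]` and each `x`, there is a finite nonnegative Borel measure `ν_x`
on `[0, ∞)` of total mass `u(x,0)` with `u(x,-t) = ∫₀^∞ e^{-ts} dν_x(s)` for `t > 0`. -/
theorem ancient_nonneg_heat_laplace_rep (n : ℕ)
    (u : EuclideanSpace ℝ (Fin n) × ℝ → ℝ)
    (hu : IsAncientHeat n u)
    (hnonneg : ∀ (x : EuclideanSpace ℝ (Fin n)) (t : ℝ), t ≤ 0 → 0 ≤ u (x, t)) :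
    ∀ x : EuclideanSpace ℝ (Fin n), ∃ ν : Measure ℝ, IsFiniteMeasure ν ∧
      ν (Set.Iio 0) = 0 ∧
      ν Set.univ = ENNReal.ofReal (u (x, 0)) ∧
      ∀ t : ℝ, 0 < t → u (x, -t) = ∫ s, Real.exp (-(t * s)) ∂ν := by
  intro x
  have hcont : Continuous fun t : ℝ => u (x, -t) :=
    hu.1.continuous.comp (by fun_prop)
  simpa using exists_measure_laplace hcont.continuousOn fun h hh => hu.isCMSeq hnonneg x hh
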